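/- Second part of Theorem 1.2: For every integer k ≥ 2, every ε > 0 and every integer d ≥ 1, there exists a constant C = C(k,ε,d) such that the following holds. If G is a finite simple graph on n vertices containing no cycle of length 2k+1 and no cycle of length 2k−1, with VC-dimension at most d and minimum degree δ(G) ≥ ε·n, then there exists a graph H with at most C vertices containing no cycle of length 2k−1, together with a graph homomorphism from G to H. -/

import Mathlib

open SimpleGraph

/-- A set `S` of vertices of a graph `G` is shattered if every subset of `S` is
a trace of a vertex neighborhood on `S`. -/
def Shattered {V : Type*} (G : SimpleGraph V) (S : Set V) : Prop :=
  ∀ S' ⊆ S, ∃ v : V, G.neighborSet v ∩ S = S'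

/-- The VC-dimension of `G` is at most `d`: every shattered set has size at most `d`. -/
def VCdimLE {V : Type*} (G : SimpleGraph V) (d : ℕ) : Prop :=
  ∀ S : Set V, Shattered G S → S.ncard ≤ d

/-- `G` contains a cycle of length `ℓ`. -/
def HasCycleOfLength {V : Type*} (G : SimpleGraph V) (ℓ : ℕ) : Prop :=
  ∃ (v : V) (w : G.Walk v v), w.IsCycle ∧ w.length = ℓ

namespace SimpleGraph

variable {V : Type*}

/-- Every set of vertices whose neighborhoods pairwise differ in more than `γ n` places is small,
if `s` is a sample size large enough with respect to `γ` and the VC-dimension `d`. -/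
theorem card_le_of_separated [Fintype V] [DecidableEq V] (G : SimpleGraph V) [DecidableRel G.Adj]
    {d s : ℕ} (hs : 1 ≤ s) {γ : ℝ} (hγ1 : γ ≤ 1)
    (hsγ : (((d + 1) * s ^ d + 1 : ℕ) : ℝ) ^ 2 * (1 - γ) ^ s < 1)
    (hG : VCdimLE G d) (R : Finset V)
    (hR : ∀ u ∈ R, ∀ v ∈ R, u ≠ v →
      γ * Fintype.card V < (symmDiff (G.neighborFinset u) (G.neighborFinset v)).card) :
    R.card ≤ (d + 1) * s ^ d := by
  by_contra! hlt
  obtain ⟨R', hR'R, hR'c⟩ := Finset.exists_subset_card_eq (show (d + 1) * s ^ d + 1 ≤ R.card by omega)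
  have hne : R'.Nonempty := by rw [← Finset.card_pos]; omega
  obtain ⟨x0, -⟩ := hne
  have hn : (0 : ℝ) < Fintype.card V := by
    exact_mod_cast Fintype.card_pos_iff.2 ⟨x0⟩
  have hsep : ∃ φ : Fin s → V, ∀ u ∈ R', ∀ v ∈ R', u ≠ v →
      ∃ i, φ i ∈ symmDiff (G.neighborFinset u) (G.neighborFinset v) := by
    by_contra! hbad
    let B : V × V → Finset (Fin s → V) := fun p =>
      Fintype.piFinset fun _ => (symmDiff (G.neighborFinset p.1) (G.neighborFinset p.2))ᶜ
    have hcover : (Finset.univ : Finset (Fin s → V)) ⊆ R'.offDiag.biUnion B := by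
      intro φ _
      obtain ⟨u, hu, v, hv, huv, h⟩ := hbad φ
      simp only [Finset.mem_biUnion, Finset.mem_offDiag]
      refine ⟨(u, v), ⟨hu, hv, huv⟩, ?_⟩
      simp only [B, Fintype.mem_piFinset, Finset.mem_compl]
      exact h
    have hB : ∀ p ∈ R'.offDiag, ((B p).card : ℝ) ≤ ((1 - γ) * Fintype.card V) ^ s := by
      intro p hp
      rw [Finset.mem_offDiag] at hp
      have h := hR p.1 (hR'R hp.1) p.2 (hR'R hp.2.1) hp.2.2
      simp only [B, Fintype.card_piFinset, Finset.prod_const, Finset.card_univ, Fintype.card_fin]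
      push_cast
      gcongr
      rw [Finset.card_compl, Nat.cast_sub (Finset.card_le_univ _)]
      linarith
    have h1 : ((Fintype.card V : ℝ)) ^ s ≤ ∑ p ∈ R'.offDiag, ((B p).card : ℝ) := by
      have := (Finset.card_le_card hcover).trans Finset.card_biUnion_le
      rw [Finset.card_univ, Fintype.card_fun, Fintype.card_fin] at this
      exact_mod_cast this
    have h2 := h1.trans (Finset.sum_le_sum hB)
    rw [Finset.sum_const, nsmul_eq_mul, mul_pow, ← mul_assoc] at h2
    have h3 : ((R'.offDiag.card : ℕ) : ℝ) ≤ (((d + 1) * s ^ d + 1 : ℕ) : ℝ) ^ 2 := by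
      rw [Finset.offDiag_card, hR'c, sq]
      exact_mod_cast Nat.sub_le _ _
    have h4 : (R'.offDiag.card : ℝ) * (1 - γ) ^ s < 1 :=
      (mul_le_mul_of_nonneg_right h3 (pow_nonneg (by linarith) _)).trans_lt hsγ
    have h5 := mul_lt_mul_of_pos_right h4 (pow_pos hn s)
    linarith
  obtain ⟨φ, hφ⟩ := hsep
  set S : Finset V := Finset.univ.image φ
  have hSc : S.card ≤ s := Finset.card_image_le.trans (by simp)
  let 𝒜 : Finset (Finset V) := R'.image fun u => G.neighborFinset u ∩ S
  have h𝒜 : 𝒜.card = R'.card := by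
    apply Finset.card_image_of_injOn
    intro u hu v hv huv
    by_contra hne
    obtain ⟨i, hi⟩ := hφ u hu v hv hne
    have hiS : φ i ∈ S := Finset.mem_image_of_mem _ (Finset.mem_univ i)
    have := Finset.ext_iff.1 huv (φ i)
    simp only [Finset.mem_inter, hiS, and_true] at this
    rw [Finset.mem_symmDiff] at hi
    tauto
  have hsub : 𝒜.shatterer ⊆ (Finset.range (d + 1)).biUnion fun i => S.powersetCard i := by
    intro T hT
    rw [Finset.mem_shatterer] at hT
    have hTS : T ⊆ S := by
      obtain ⟨u, hu, huT⟩ := hT (Finset.Subset.refl T)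
      obtain ⟨v, -, rfl⟩ := Finset.mem_image.1 hu
      exact (Finset.inter_eq_left.1 huT).trans Finset.inter_subset_right
    have hTG : Shattered G (T : Set V) := by
      intro S' hS'
      obtain ⟨S', rfl⟩ := (T.finite_toSet.subset hS').exists_finset_coe
      obtain ⟨u, hu, huT⟩ := hT (Finset.coe_subset.1 hS')
      obtain ⟨v, -, rfl⟩ := Finset.mem_image.1 hu
      refine ⟨v, ?_⟩
      ext x
      have := Finset.ext_iff.1 huT x
      simp only [Finset.mem_inter, mem_neighborFinset] at this
      simp only [Set.mem_inter_iff, mem_neighborSet, Finset.mem_coe]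
      have := @hTS x
      tauto
    have hTd := hG _ hTG
    rw [Set.ncard_coe_finset] at hTd
    simp only [Finset.mem_biUnion, Finset.mem_range, Finset.mem_powersetCard]
    exact ⟨T.card, by omega, hTS, rfl⟩
  have hcard : 𝒜.card ≤ (d + 1) * s ^ d := by
    refine (Finset.card_le_card_shatterer 𝒜).trans ((Finset.card_le_card hsub).trans ?_)
    refine (Finset.card_biUnion_le_card_mul _ _ (s ^ d) ?_).trans (by simp)
    intro i hi
    rw [Finset.card_powersetCard]
    rw [Finset.mem_range] at hi
    exact (Nat.choose_le_pow _ _).trans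
      ((Nat.pow_le_pow_left hSc _).trans (Nat.pow_le_pow_right hs (by omega)))
  omega

theorem exists_sample_size (d : ℕ) {γ : ℝ} (hγ : 0 < γ) (hγ1 : γ ≤ 1) :
    ∃ s : ℕ, 1 ≤ s ∧ (((d + 1) * s ^ d + 1 : ℕ) : ℝ) ^ 2 * (1 - γ) ^ s < 1 := by
  have h := (tendsto_pow_const_mul_const_pow_of_abs_lt_one (2 * d) (r := 1 - γ)
    (by rw [abs_lt]; constructor <;> linarith)).const_mul (((d : ℝ) + 2) ^ 2)
  rw [mul_zero] at h
  obtain ⟨s, hs, hs1⟩ := ((h.eventually_lt_const one_pos).and (Filter.eventually_ge_atTop 1)).exists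
  refine ⟨s, hs1, lt_of_le_of_lt ?_ hs⟩
  rw [← mul_assoc]
  refine mul_le_mul_of_nonneg_right ?_ (pow_nonneg (by linarith) _)
  have h1 : (1 : ℝ) ≤ (s : ℝ) ^ d := one_le_pow₀ (by exact_mod_cast hs1)
  rw [mul_comm 2 d, pow_mul, ← mul_pow]
  push_cast
  gcongr
  nlinarith

/-- Graphs of bounded VC-dimension and linear minimum degree admit a vertex partition into
boundedly many parts, any two vertices of a part having linearly many common neighbors. -/
theorem exists_coloring_commonNeighbors (d : ℕ) {ε : ℝ} (hε : 0 < ε) (hε1 : ε ≤ 1) :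
    ∃ m : ℕ, ∀ (V : Type) [Fintype V] (G : SimpleGraph V), VCdimLE G d →
      (∀ v : V, ε * Nat.card V ≤ (G.neighborSet v).ncard) →
      ∃ cl : V → Fin m, ∀ u v, cl u = cl v →
        ε / 2 * Nat.card V ≤ (G.neighborSet u ∩ G.neighborSet v).ncard := by
  classical
  obtain ⟨s, hs, hsγ⟩ := exists_sample_size d (γ := ε / 4) (by linarith) (by linarith)
  refine ⟨(d + 1) * s ^ d, fun V _ G hG hdeg => ?_⟩
  let sep : Finset V → Prop := fun R => ∀ u ∈ R, ∀ v ∈ R, u ≠ v →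
    ε / 4 * Fintype.card V < (symmDiff (G.neighborFinset u) (G.neighborFinset v)).card
  obtain ⟨R, hR, hmax⟩ := (Finset.univ.filter sep).exists_max_image Finset.card
    ⟨∅, by simp [sep]⟩
  simp only [Finset.mem_filter, Finset.mem_univ, true_and] at hR hmax
  have hRc := G.card_le_of_separated hs (by linarith) hsγ hG R hR
  have hnear : ∀ v, ∃ r ∈ R,
      ((symmDiff (G.neighborFinset v) (G.neighborFinset r)).card : ℝ) ≤ ε / 4 * Fintype.card V := by
    intro v
    by_contra! hv
    have hvR : v ∉ R := by
      intro hvR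
      have := hv v hvR
      rw [symmDiff_self] at this
      have h0 : (0 : ℝ) ≤ ε / 4 * Fintype.card V := by positivity
      simp only [Finset.bot_eq_empty, Finset.card_empty, Nat.cast_zero] at this
      linarith
    have := hmax (insert v R) (by
      intro u hu w hw huw
      rw [Finset.mem_insert] at hu hw
      rcases hu with rfl | hu <;> rcases hw with rfl | hw
      · exact absurd rfl huw
      · exact hv w hw
      · rw [symmDiff_comm]; exact hv u hu
      · exact hR u hu w hw huw)
    rw [Finset.card_insert_of_notMem hvR] at this
    omega
  choose r hrR hr using hnear
  refine ⟨fun v => Fin.castLE hRc (R.equivFin ⟨r v, hrR v⟩), fun u v huv => ?_⟩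
  have hruv : r u = r v := by
    have := R.equivFin.injective (Fin.castLE_injective hRc huv)
    exact congrArg Subtype.val this
  have hu := hr u
  have hv := hr v
  rw [← hruv] at hv
  have hd := hdeg u
  have e1 : (G.neighborSet u).ncard = (G.neighborFinset u).card := by
    rw [← Set.ncard_coe_finset, coe_neighborFinset]
  have e2 : (G.neighborSet u ∩ G.neighborSet v).ncard
      = (G.neighborFinset u ∩ G.neighborFinset v).card := by
    rw [← Set.ncard_coe_finset, Finset.coe_inter, coe_neighborFinset, coe_neighborFinset]
  rw [e1] at hd
  rw [e2]
  rw [Nat.card_eq_fintype_card] at hd ⊢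
  have hsub : G.neighborFinset u ⊆ (G.neighborFinset u ∩ G.neighborFinset v) ∪
      (symmDiff (G.neighborFinset u) (G.neighborFinset (r u)) ∪
        symmDiff (G.neighborFinset v) (G.neighborFinset (r u))) := by
    intro x hx
    simp only [Finset.mem_union, Finset.mem_inter, Finset.mem_symmDiff]
    tauto
  have hc : ((G.neighborFinset u).card : ℝ) ≤ (G.neighborFinset u ∩ G.neighborFinset v).card +
      ((symmDiff (G.neighborFinset u) (G.neighborFinset (r u))).card +
        (symmDiff (G.neighborFinset v) (G.neighborFinset (r u))).card) := by
    exact_mod_cast (Finset.card_le_card hsub).trans ((Finset.card_union_le _ _).trans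
      (Nat.add_le_add_left (Finset.card_union_le _ _) _))
  linarith


/-- `f` runs periodically around a cycle of `G` with `r` vertices. -/
structure IsCycleSeq (G : SimpleGraph V) (r : ℕ) (f : ℕ → V) : Prop where
  adj : ∀ n, G.Adj (f n) (f (n + 1))
  periodic : ∀ n, f (n + r) = f n
  injOn : ∀ a < r, ∀ b < r, f a = f b → a = b

variable {G : SimpleGraph V}

theorem Walk.IsPath.isCycleSeq {u v : V} {p : G.Walk u v} (hp : p.IsPath) (h : G.Adj v u) :
    IsCycleSeq G (p.length + 1) fun n => p.getVert (n % (p.length + 1)) := by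
  refine ⟨fun n => ?_, fun n => by simp, fun a ha b hb hab => ?_⟩
  · have hlt := Nat.mod_lt n (show 0 < p.length + 1 by omega)
    rcases Nat.lt_or_ge (n % (p.length + 1)) p.length with h1 | h1
    · have : (n + 1) % (p.length + 1) = n % (p.length + 1) + 1 := by
        rw [Nat.add_mod, Nat.mod_eq_of_lt (a := 1) (by omega), Nat.mod_eq_of_lt (by omega)]
      simp only [this]
      exact p.adj_getVert_succ h1
    · have h2 : n % (p.length + 1) = p.length := by omega
      have : (n + 1) % (p.length + 1) = 0 := by
        rw [Nat.add_mod, h2]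
        rcases Nat.eq_zero_or_pos p.length with h0 | h0
        · simp [h0]
        · rw [Nat.mod_eq_of_lt (a := 1) (by omega), Nat.mod_self]
      simp only [this, h2]
      simpa using h
  · simp only [Nat.mod_eq_of_lt ha, Nat.mod_eq_of_lt hb] at hab
    exact hp.getVert_injOn (by simp; omega) (by simp; omega) hab

theorem Walk.IsPath.hasCycleOfLength {u v : V} {p : G.Walk u v} (hp : p.IsPath)
    (h : G.Adj v u) (hl : 2 ≤ p.length) : HasCycleOfLength G (p.length + 1) := by
  refine ⟨v, Walk.cons h p, ?_, by simp⟩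
  rw [Walk.cons_isCycle_iff]
  refine ⟨hp, fun hmem => ?_⟩
  rw [Sym2.eq_swap] at hmem
  have := hp.length_eq_one_of_mem_edges hmem
  omega

theorem exists_isPath_of_injOn {f : ℕ → V} (n : ℕ) (hadj : ∀ i < n, G.Adj (f i) (f (i + 1)))
    (hinj : ∀ a ≤ n, ∀ b ≤ n, f a = f b → a = b) :
    ∃ p : G.Walk (f 0) (f n), p.IsPath ∧ p.length = n ∧ ∀ x ∈ p.support, ∃ i ≤ n, x = f i := by
  induction n with
  | zero => exact ⟨Walk.nil, Walk.IsPath.nil, rfl, by simp⟩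
  | succ n ih =>
    obtain ⟨p, hp, hl, hs⟩ := ih (fun i hi => hadj i (by omega))
      (fun a ha b hb => hinj a (by omega) b (by omega))
    refine ⟨p.concat (hadj n (by omega)), hp.concat (fun hmem => ?_) _, by simp [hl], ?_⟩
    · obtain ⟨i, hi, h⟩ := hs _ hmem
      have := hinj _ le_rfl _ (by omega) h
      omega
    · intro x hx
      rw [Walk.support_concat, List.mem_append, List.mem_singleton] at hx
      rcases hx with hx | rfl
      · obtain ⟨i, hi, h⟩ := hs _ hx
        exact ⟨i, by omega, h⟩
      · exact ⟨n + 1, le_rfl, rfl⟩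

theorem IsCycleSeq.hasCycleOfLength {r : ℕ} {f : ℕ → V} (hf : IsCycleSeq G r f) (hr : 3 ≤ r) :
    HasCycleOfLength G r := by
  obtain ⟨r, rfl⟩ : ∃ s, r = s + 1 := ⟨r - 1, by omega⟩
  obtain ⟨p, hp, hl, -⟩ := exists_isPath_of_injOn (G := G) (f := f) r (fun i _ => hf.adj i)
    (fun a ha b hb => hf.injOn a (by omega) b (by omega))
  have h := hf.adj r
  rw [show r + 1 = 0 + (r + 1) by omega, hf.periodic] at h
  have := hp.hasCycleOfLength h (by omega)
  rwa [hl] at this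

theorem exists_isCycleSeq_of_hasCycleOfLength {ℓ : ℕ} (h : HasCycleOfLength G ℓ) :
    ∃ f, IsCycleSeq G ℓ f := by
  obtain ⟨v, w, hw, rfl⟩ := h
  cases w with
  | nil => exact absurd rfl hw.ne_nil
  | cons h p =>
    rw [Walk.cons_isCycle_iff] at hw
    exact ⟨_, hw.1.isCycleSeq h⟩

theorem IsCycleSeq.add_mul {r : ℕ} {f : ℕ → V} (hf : IsCycleSeq G r f) (n q : ℕ) :
    f (n + q * r) = f n := by
  induction q with
  | zero => simp
  | succ q ih => rw [Nat.succ_mul, ← add_assoc, hf.periodic, ih]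

theorem IsCycleSeq.apply_mod {r : ℕ} {f : ℕ → V} (hf : IsCycleSeq G r f) (n : ℕ) :
    f (n % r) = f n := by
  conv_rhs => rw [← Nat.mod_add_div n r, mul_comm, hf.add_mul]

theorem IsCycleSeq.eq_iff {r : ℕ} {f : ℕ → V} (hf : IsCycleSeq G r f) (hr : 0 < r) (a b : ℕ) :
    f a = f b ↔ a ≡ b [MOD r] := by
  constructor
  · intro h
    rw [← hf.apply_mod a, ← hf.apply_mod b] at h
    exact hf.injOn _ (Nat.mod_lt _ hr) _ (Nat.mod_lt _ hr) h
  · intro h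
    rw [← hf.apply_mod a, ← hf.apply_mod b, h]

theorem IsCycleSeq.eq_of_le {r : ℕ} {f : ℕ → V} (hf : IsCycleSeq G r f) {a b : ℕ}
    (hab : a ≤ b) (hbr : b < a + r) (h : f a = f b) : a = b := by
  have := (Nat.modEq_iff_dvd' hab).1 ((hf.eq_iff (by omega) a b).1 h)
  have := Nat.eq_zero_of_dvd_of_lt this (by omega)
  omega

/-- A walk whose vertex repetitions all occur at even distance contains a path of the same
parity with the same ends. -/
theorem exists_isPath_of_even_repetitions {f : ℕ → V} {i j : ℕ} (hij : i ≤ j)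
    (hadj : ∀ n, i ≤ n → n < j → G.Adj (f n) (f (n + 1)))
    (heven : ∀ a b, i ≤ a → a < b → b ≤ j → f a = f b → Even (b - a)) :
    ∃ p : G.Walk (f i) (f j), p.IsPath ∧ p.length ≤ j - i ∧ (Even p.length ↔ Even (j - i)) ∧
      ∀ x ∈ p.support, ∃ n, i ≤ n ∧ n ≤ j ∧ x = f n := by
  classical
  induction hm : j - i using Nat.strong_induction_on generalizing i with
  | _ m ih =>
  subst hm
  obtain ⟨b, hb, hbmax⟩ : ∃ b, (i ≤ b ∧ b ≤ j ∧ f b = f i) ∧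
      ∀ c, b < c → c ≤ j → f c ≠ f i := by
    let P : ℕ → Prop := fun b => i ≤ b ∧ b ≤ j ∧ f b = f i
    have hP : P i := ⟨le_rfl, hij, rfl⟩
    refine ⟨Nat.findGreatest P j, Nat.findGreatest_spec hij hP, fun c hc hcj h => ?_⟩
    have := Nat.le_findGreatest hij hP
    exact Nat.findGreatest_is_greatest hc hcj ⟨by omega, hcj, h⟩
  obtain ⟨hib, hbj, hfb⟩ := hb
  have hbi : Even (b - i) := by
    rcases hib.eq_or_lt with rfl | hlt
    · simp
    · exact heven i b le_rfl hlt hbj hfb.symm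
  rcases hbj.eq_or_lt with rfl | hlt
  · exact ⟨Walk.nil.copy rfl hfb.symm, by simp, by simp, by simp [hbi], by
      simp only [Walk.support_copy, Walk.support_nil, List.mem_singleton]
      rintro x rfl
      exact ⟨i, le_rfl, hij, rfl⟩⟩
  · obtain ⟨p, hp, hl, hpar, hs⟩ := ih (j - (b + 1)) (by omega) (i := b + 1) hlt
      (fun n hn => hadj n (by omega)) (fun a c ha => heven a c (by omega)) rfl
    have h := hadj b hib hlt
    rw [hfb] at h
    refine ⟨Walk.cons h p, hp.cons fun hmem => ?_, ?_, ?_, ?_⟩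
    · obtain ⟨n, hn, hnj, h⟩ := hs _ hmem
      exact hbmax n (by omega) hnj h.symm
    · rw [Walk.length_cons]; omega
    · rw [Walk.length_cons, Nat.even_add_one, hpar,
        show j - i = (j - (b + 1) + 1) + (b - i) by omega, Nat.even_add, Nat.even_add_one]
      tauto
    · intro x hx
      rw [Walk.support_cons, List.mem_cons] at hx
      rcases hx with rfl | hx
      · exact ⟨i, le_rfl, hij, rfl⟩
      · obtain ⟨n, hn, hnj, h⟩ := hs _ hx
        exact ⟨n, by omega, hnj, h⟩

theorem hasCycleOfLength_of_isPath_of_isPath {u w : V} {p : G.Walk u w} {q : G.Walk w u}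
    (huw : u ≠ w) (hp : p.IsPath) (hq : q.IsPath) (hql : 2 ≤ q.length)
    (hdisj : ∀ x ∈ p.support, x ∈ q.support → x = u ∨ x = w) :
    HasCycleOfLength G (p.length + q.length) := by
  cases p with
  | nil => exact absurd rfl huw
  | cons h p =>
    rw [Walk.cons_isPath_iff] at hp
    have hpq : (p.append q).IsPath := by
      rw [Walk.isPath_def, Walk.support_append, List.nodup_append]
      have hq' := hq.support_nodup
      rw [← Walk.cons_tail_support, List.nodup_cons] at hq'
      refine ⟨hp.1.support_nodup, hq'.2, fun a ha b hb hab => ?_⟩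
      subst hab
      rcases hdisj a (by simp [ha]) (List.mem_of_mem_tail hb) with rfl | rfl
      · exact hp.2 ha
      · exact hq'.1 hb
    have := hpq.hasCycleOfLength h (by rw [Walk.length_append]; omega)
    rwa [Walk.length_append, Nat.add_right_comm] at this

theorem exists_even_isPath [Finite V] {α : Type*} [Fintype α] {cl : V → α} {K : ℕ}
    (hcl : ∀ u v, cl u = cl v →
      Fintype.card α + K < (G.neighborSet u ∩ G.neighborSet v).ncard) (t : ℕ) :
    ∀ u w, u ≠ w → cl u = cl w → ∀ F : Finset V, F.card + 2 * (t + 1) ≤ K →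
      ∃ q : G.Walk w u, q.IsPath ∧ q.length = 2 * (t + 1) ∧
        ∀ x ∈ q.support, x ∈ F → x = u ∨ x = w := by
  classical
  have key : ∀ u w, cl u = cl w → ∀ F : Finset V, F.card ≤ K → ∃ a b, a ≠ b ∧ cl a = cl b ∧
      a ∉ F ∧ b ∉ F ∧ G.Adj u a ∧ G.Adj w a ∧ G.Adj u b ∧ G.Adj w b := by
    intro u w h F hF
    have := Fintype.ofFinite V
    have hA : Fintype.card α < ((G.neighborSet u ∩ G.neighborSet w) \ F).ncard := by
      have := Set.le_ncard_sdiff (F : Set V) (G.neighborSet u ∩ G.neighborSet w)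
      rw [Set.ncard_coe_finset] at this
      have := hcl u w h
      omega
    rw [Set.ncard_eq_toFinset_card', ← Finset.card_univ] at hA
    obtain ⟨a, ha, b, hb, hab, hc⟩ := Finset.exists_ne_map_eq_of_card_lt_of_maps_to hA
      (f := cl) (fun _ _ => Finset.mem_coe.2 (Finset.mem_univ _))
    simp only [Set.mem_toFinset, Set.mem_sdiff, Set.mem_inter_iff, mem_neighborSet,
      Finset.mem_coe] at ha hb
    exact ⟨a, b, hab, hc, ha.2, hb.2, ha.1.1, ha.1.2, hb.1.1, hb.1.2⟩
  induction t with
  | zero =>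
    intro u w huw h F hF
    obtain ⟨a, -, -, -, ha, -, hua, hwa, -, -⟩ := key u w h F (by omega)
    refine ⟨Walk.cons hwa (Walk.cons hua.symm Walk.nil), ?_, rfl, ?_⟩
    · simp [Walk.cons_isPath_iff, hwa.ne, hua.ne', huw.symm]
    · simp only [Walk.support_cons, Walk.support_nil, List.mem_cons, List.not_mem_nil, or_false]
      rintro x (rfl | rfl | rfl) hx
      · exact Or.inr rfl
      · exact absurd hx ha
      · exact Or.inl rfl
  | succ t ih =>
    intro u w huw h F hF
    obtain ⟨a, b, hab, hc, ha, hb, hua, hwa, hub, hwb⟩ := key u w h F (by omega)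
    obtain ⟨q, hq, hl, hs⟩ := ih a b hab hc (insert u (insert w F)) (by
      have := Finset.card_insert_le u (insert w F)
      have := Finset.card_insert_le w F
      omega)
    have hs' : ∀ x ∈ q.support, x ≠ u ∧ x ≠ w ∧ x ∉ F := by
      intro x hx
      by_contra hcon
      have hxF : x ∈ insert u (insert w F) := by
        simp only [Finset.mem_insert]; tauto
      rcases hs x hx hxF with rfl | rfl
      · exact hcon ⟨hua.ne', hwa.ne', ha⟩
      · exact hcon ⟨hub.ne', hwb.ne', hb⟩
    refine ⟨Walk.cons hwb (q.concat hua.symm), ?_, ?_, ?_⟩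
    · refine (hq.concat (fun hu => (hs' u hu).1 rfl) _).cons ?_
      rw [Walk.support_concat, List.mem_append, List.mem_singleton]
      rintro (hw | rfl)
      · exact (hs' w hw).2.1 rfl
      · exact huw rfl
    · rw [Walk.length_cons, Walk.length_concat]; omega
    · intro x hx hxF
      rw [Walk.support_cons, Walk.support_concat, List.mem_cons, List.mem_append,
        List.mem_singleton] at hx
      rcases hx with rfl | hx | rfl
      · exact Or.inr rfl
      · exact absurd hxF (hs' x hx).2.2
      · exact Or.inl rfl

/-- If vertices of equal color have many common neighbors and `G` has no cycle of length
`2k + 1`, then distinct vertices of equal color are not joined by odd paths of length less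
than `2k`. -/
theorem two_mul_le_length_of_odd_isPath [Finite V] {α : Type*} [Fintype α] {cl : V → α} {k : ℕ}
    (hcl : ∀ u v, cl u = cl v →
      Fintype.card α + 4 * k < (G.neighborSet u ∩ G.neighborSet v).ncard)
    (hG : ¬ HasCycleOfLength G (2 * k + 1)) {u w : V} (huw : u ≠ w) (h : cl u = cl w)
    {p : G.Walk u w} (hp : p.IsPath) (hodd : Odd p.length) : 2 * k ≤ p.length := by
  classical
  by_contra! hlt
  obtain ⟨s, hs⟩ := hodd
  obtain ⟨q, hq, hql, hqs⟩ := exists_even_isPath hcl (k - s - 1) u w huw h p.support.toFinset (by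
    have := p.support.toFinset_card_le
    rw [Walk.length_support] at this
    omega)
  have := hasCycleOfLength_of_isPath_of_isPath huw hp hq (by omega)
    (fun x hx hxq => hqs x hxq (List.mem_toFinset.2 hx))
  rw [hql, hs, show 2 * s + 1 + 2 * (k - s - 1 + 1) = 2 * k + 1 by omega] at this
  exact hG this

theorem IsCycleSeq.exists_isPath {r : ℕ} {f : ℕ → V} (hf : IsCycleSeq G r f) {a b : ℕ}
    (hab : a ≤ b) (hbr : b < a + r) :
    ∃ p : G.Walk (f a) (f b), p.IsPath ∧ p.length ≤ b - a ∧ (Even p.length ↔ Even (b - a)) ∧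
      ∀ x ∈ p.support, ∃ n, x = f n := by
  obtain ⟨p, hp, hl, hpar, hs⟩ := exists_isPath_of_even_repetitions (G := G) (f := f) hab
    (fun n _ _ => hf.adj n) (fun c d hc hcd hd h => by
      have := hf.eq_of_le hcd.le (by omega) h
      omega)
  exact ⟨p, hp, hl, hpar, fun x hx => by obtain ⟨n, -, -, h⟩ := hs x hx; exact ⟨n, h⟩⟩

section ShortCycles

variable {α : Type*} {cl : V → α} {k : ℕ}

theorem IsCycleSeq.injOn_color
    (hsep : ∀ u w, u ≠ w → cl u = cl w → ∀ p : G.Walk u w, p.IsPath → Odd p.length →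
      2 * k ≤ p.length)
    {r : ℕ} {f : ℕ → V} (hf : IsCycleSeq G r f) (hodd : Odd r) (hr : r < 2 * k)
    {a b : ℕ} (h : cl (f a) = cl (f b)) : f a = f b := by
  have hr0 : 0 < r := hodd.pos
  suffices H : ∀ a b, a < r → b < r → a < b → cl (f a) = cl (f b) → f a = f b by
    rw [← hf.apply_mod a, ← hf.apply_mod b] at h ⊢
    have ha := Nat.mod_lt a hr0
    have hb := Nat.mod_lt b hr0
    rcases lt_trichotomy (a % r) (b % r) with h1 | h1 | h1
    · exact H _ _ ha hb h1 h
    · rw [h1]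
    · exact (H _ _ hb ha h1 h.symm).symm
  intro a b ha hb hab h
  by_contra hne
  rcases Nat.even_or_odd (b - a) with he | ho
  · obtain ⟨p, hp, hl, hpar, -⟩ := hf.exists_isPath (a := b) (b := a + r) (by omega) (by omega)
    rw [show a + r - b = r - (b - a) by omega] at hpar
    have : Odd p.length := by
      rw [← Nat.not_even_iff_odd, hpar, Nat.not_even_iff_odd]
      exact Nat.Odd.sub_even (by omega) hodd he
    have := hsep _ _ (by rw [hf.periodic]; exact fun h => hne h.symm)
      (by rw [hf.periodic]; exact h.symm) p hp this
    omega
  · obtain ⟨p, hp, hl, hpar, -⟩ := hf.exists_isPath (a := a) (b := b) (by omega) (by omega)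
    have : Odd p.length := by
      rwa [← Nat.not_even_iff_odd, hpar, Nat.not_even_iff_odd]
    have := hsep _ _ hne h p hp this
    omega

/-- A short odd cycle is determined by the colors of its vertices. -/
theorem IsCycleSeq.apply_zero_eq_of_color_eq
    (hsep : ∀ u w, u ≠ w → cl u = cl w → ∀ p : G.Walk u w, p.IsPath → Odd p.length →
      2 * k ≤ p.length)
    (hcn : ∀ u v, cl u = cl v → ∀ F : Finset V, F.card ≤ 4 * k →
      ∃ y ∉ F, G.Adj u y ∧ G.Adj v y)
    {r : ℕ} {f g : ℕ → V} (hf : IsCycleSeq G r f) (hg : IsCycleSeq G r g) (hodd : Odd r)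
    (hr : r + 2 < 2 * k) (h : ∀ n, cl (f n) = cl (g n)) : f 0 = g 0 := by
  classical
  have hr0 : 0 < r := hodd.pos
  have hmeet : ∀ a b, f a = g b → f b = g b := by
    intro a b hab
    rw [← hab]
    exact (hf.injOn_color hsep hodd (by omega) (by rw [hab, h b])).symm
  have hstep : ∀ i, f i = g i → f (i + 1) = g (i + 1) := by
    intro i hi
    by_contra hne
    obtain ⟨p, hp, hl, hpar, hs⟩ := hf.exists_isPath (a := i + 1) (b := i + r) (by omega) (by omega)
    have hadj : G.Adj (f (i + r)) (g (i + 1)) := by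
      rw [hf.periodic, hi]; exact hg.adj i
    have hP : (p.concat hadj).IsPath := hp.concat (fun hmem => by
      obtain ⟨n, hn⟩ := hs _ hmem
      exact hne (hmeet _ _ hn.symm)) _
    have := hsep _ _ hne (h _) _ hP (by
      rw [Walk.length_concat]
      rw [← Nat.not_even_iff_odd, Nat.even_add_one, hpar, not_not]
      rw [show i + r - (i + 1) = r - 1 by omega]
      exact Nat.Odd.sub_odd hodd odd_one)
    rw [Walk.length_concat] at this
    omega
  by_contra hne
  have hall : ∀ i, f i ≠ g i := by
    intro i hi
    have hge : ∀ n, f (i + n) = g (i + n) := by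
      intro n
      induction n with
      | zero => exact hi
      | succ n ih => exact hstep _ ih
    have := hge (i * r - i)
    rw [show i + (i * r - i) = 0 + i * r by
      have := Nat.le_mul_of_pos_right i hr0
      omega, hf.add_mul, hg.add_mul] at this
    exact hne this
  have hdisj : ∀ a b, f a ≠ g b := fun a b hab => hall b (hmeet a b hab)
  obtain ⟨p, hp, hl, hpar, hs⟩ := hf.exists_isPath (a := 1) (b := 0 + r) (by omega) (by omega)
  obtain ⟨y, hyF, hfy, hgy⟩ := hcn (f 0) (g 0) (h 0) (insert (g 1) p.support.toFinset) (by
    have h1 := p.support.toFinset_card_le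
    have h2 := Finset.card_insert_le (g 1) p.support.toFinset
    rw [Walk.length_support] at h1
    omega)
  simp only [Finset.mem_insert, List.mem_toFinset, not_or] at hyF
  have hfy' : G.Adj (f (0 + r)) y := by rwa [hf.periodic]
  have hP : (((p.concat hfy').concat hgy.symm).concat (hg.adj 0)).IsPath := by
    refine ((hp.concat hyF.2 _).concat ?_ _).concat ?_ _
    · rw [Walk.support_concat, List.mem_append, List.mem_singleton]
      rintro (hm | hm)
      · obtain ⟨n, hn⟩ := hs _ hm
        exact hdisj _ _ hn.symm
      · exact hgy.ne hm
    · rw [Walk.support_concat, Walk.support_concat, List.mem_append, List.mem_append,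
        List.mem_singleton, List.mem_singleton]
      rintro ((hm | hm) | hm)
      · obtain ⟨n, hn⟩ := hs _ hm
        exact hdisj _ _ hn.symm
      · exact hyF.1 hm.symm
      · exact (hg.adj 0).ne hm.symm
  have := hsep _ _ (hall 1) (h 1) _ hP (by
    simp only [Walk.length_concat]
    rw [← Nat.not_even_iff_odd]
    simp only [Nat.even_add_one, hpar, not_not]
    rw [show 0 + r - 1 = r - 1 by omega]
    exact Nat.Odd.sub_odd hodd odd_one)
  simp only [Walk.length_concat] at this
  omega

/-- The color of a vertex, together with the color patterns of the short odd cycles based at it. -/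
def cycleColor (G : SimpleGraph V) (cl : V → α) (k : ℕ) (v : V) :
    α × Set (Fin (2 * k) × (Fin (2 * k) → α)) :=
  (cl v, {x | ∃ g, IsCycleSeq G x.1 g ∧ g 0 = v ∧ ∀ i : Fin (2 * k), cl (g i) = x.2 i})

theorem eq_of_cycleColor_eq
    (hsep : ∀ u w, u ≠ w → cl u = cl w → ∀ p : G.Walk u w, p.IsPath → Odd p.length →
      2 * k ≤ p.length)
    (hcn : ∀ u v, cl u = cl v → ∀ F : Finset V, F.card ≤ 4 * k →
      ∃ y ∉ F, G.Adj u y ∧ G.Adj v y)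
    {r : ℕ} {f : ℕ → V} (hf : IsCycleSeq G r f) (hodd : Odd r) (hr : r + 2 < 2 * k) {v : V}
    (h : cycleColor G cl k v = cycleColor G cl k (f 0)) : v = f 0 := by
  have hmem : ((⟨r, by omega⟩, fun i => cl (f i)) : Fin (2 * k) × (Fin (2 * k) → α)) ∈
      (cycleColor G cl k (f 0)).2 := ⟨f, hf, rfl, fun _ => rfl⟩
  rw [← h] at hmem
  obtain ⟨g, hg, hg0, hgf⟩ := hmem
  rw [← hg0]
  refine (hf.apply_zero_eq_of_color_eq hsep hcn hg hodd hr fun n => ?_).symm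
  have hn := Nat.mod_lt n hodd.pos
  have := hgf ⟨n % r, by omega⟩
  simp only [hf.apply_mod] at this
  rw [← this, hg.apply_mod]

end ShortCycles

theorem exists_minimal_odd_repetition {f : ℕ → V} {N : ℕ}
    (hadj : ∀ n < N, G.Adj (f n) (f (n + 1))) {i j : ℕ} (hij : i < j) (hjN : j ≤ N)
    (hodd : Odd (j - i)) (h : f i = f j) :
    ∃ a b, a < b ∧ b ≤ N ∧ b - a ≤ j - i ∧ f a = f b ∧
      (∀ c d, c < d → d ≤ N → Odd (d - c) → f c = f d → b - a ≤ d - c) ∧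
      ∃ r g, IsCycleSeq G r g ∧ Odd r ∧ 3 ≤ r ∧ r ≤ b - a ∧ g 0 = f a := by
  classical
  let P : ℕ → Prop := fun m => ∃ a b, a < b ∧ b ≤ N ∧ Odd (b - a) ∧ f a = f b ∧ b - a = m
  have hP : ∃ m, P m := ⟨_, i, j, hij, hjN, hodd, h, rfl⟩
  obtain ⟨a, b, hab, hbN, ho, heq, hm⟩ := Nat.find_spec hP
  have hmin : ∀ c d, c < d → d ≤ N → Odd (d - c) → f c = f d → b - a ≤ d - c := by
    intro c d h1 h2 h3 h4
    rw [hm]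
    exact Nat.find_min' hP ⟨c, d, h1, h2, h3, h4, rfl⟩
  refine ⟨a, b, hab, hbN, hmin i j hij hjN hodd h, heq, hmin, ?_⟩
  obtain ⟨p, hp, hl, hpar, -⟩ := exists_isPath_of_even_repetitions (G := G) (f := f)
    (i := a) (j := b - 1) (by omega) (fun n _ _ => hadj n (by omega)) (fun c d hc hcd hd he => by
      by_contra hne
      have := hmin c d hcd (by omega) (Nat.not_even_iff_odd.1 hne) he
      omega)
  have hback : G.Adj (f (b - 1)) (f a) := by
    have := hadj (b - 1) (by omega)
    rwa [Nat.sub_add_cancel (by omega), ← heq] at this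
  have hev : Even p.length := by
    rw [hpar, show b - 1 - a = b - a - 1 by omega]
    exact Nat.Odd.sub_odd ho odd_one
  have hpos : p.length ≠ 0 := fun h0 => hback.ne (Walk.eq_of_length_eq_zero h0).symm
  obtain ⟨s, hs⟩ := hev
  exact ⟨_, _, hp.isCycleSeq hback, ⟨s, by omega⟩, by omega, by omega, by simp⟩

/-- The colors of the `l`-th refinement: a color of the previous level and a set of such colors. -/
def RefinedColor (α : Type) : ℕ → Type
  | 0 => α
  | l + 1 => RefinedColor α l × Set (RefinedColor α l)

instance (α : Type) [Finite α] (l : ℕ) : Finite (RefinedColor α l) := by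
  induction l with
  | zero => exact ‹Finite α›
  | succ l ih => exact inferInstanceAs (Finite (RefinedColor α l × Set (RefinedColor α l)))

/-- Color refinement: each vertex records the previous colors of itself and of its neighbors. -/
def refinedColor (G : SimpleGraph V) {α : Type} (c : V → α) : (l : ℕ) → V → RefinedColor α l
  | 0, v => c v
  | l + 1, v => (refinedColor G c l v, refinedColor G c l '' G.neighborSet v)

theorem eq_of_refinedColor_eq {α : Type} {c : V → α} {l : ℕ} {u v : V}
    (h : refinedColor G c l u = refinedColor G c l v) : c u = c v := by
  induction l with
  | zero => exact h
  | succ l ih => exact ih (congrArg Prod.fst h)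

theorem refinedColor_eq_of_le {α : Type} {c : V → α} {l m : ℕ} (hlm : l ≤ m) {u v : V}
    (h : refinedColor G c m u = refinedColor G c m v) :
    refinedColor G c l u = refinedColor G c l v := by
  induction m, hlm using Nat.le_induction with
  | base => exact h
  | succ m _ ih => exact ih (congrArg Prod.fst h)

theorem exists_adj_of_refinedColor_eq {α : Type} {c : V → α} {l : ℕ} {u v w : V}
    (h : refinedColor G c (l + 1) u = refinedColor G c (l + 1) v) (hvw : G.Adj v w) :
    ∃ x, G.Adj u x ∧ refinedColor G c l x = refinedColor G c l w := by
  have h2 : refinedColor G c l '' G.neighborSet u = refinedColor G c l '' G.neighborSet v :=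
    congrArg Prod.snd h
  have : refinedColor G c l w ∈ refinedColor G c l '' G.neighborSet u :=
    h2 ▸ Set.mem_image_of_mem _ hvw
  exact this

/-- The graph on the colors of `c` in which two colors are adjacent if some edge joins them. -/
def colorGraph {β : Type*} (G : SimpleGraph V) (c : V → β) : SimpleGraph β where
  Adj S T := S ≠ T ∧ ∃ u v, G.Adj u v ∧ c u = S ∧ c v = T
  symm := ⟨fun _ _ ⟨h, u, v, huv, hu, hv⟩ => ⟨h.symm, v, u, huv.symm, hv, hu⟩⟩
  loopless := ⟨fun _ h => h.1 rfl⟩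

theorem not_hasCycleOfLength_colorGraph {α : Type} {c : V → α} {k : ℕ} (hk : 2 ≤ k)
    (hsep : ∀ u w, u ≠ w → c u = c w → ∀ p : G.Walk u w, p.IsPath → Odd p.length →
      2 * k ≤ p.length)
    (hcyc : ∀ r f, IsCycleSeq G r f → Odd r → r + 2 < 2 * k → ∀ v, c v = c (f 0) → v = f 0)
    (hG : ¬ HasCycleOfLength G (2 * k - 1)) :
    ¬ HasCycleOfLength (colorGraph G (refinedColor G c (2 * k - 1))) (2 * k - 1) := by
  classical
  intro hH
  have hℓodd : Odd (2 * k - 1) := ⟨k - 1, by omega⟩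
  have hℓ3 : 3 ≤ 2 * k - 1 := by omega
  have hℓk : 2 * k - 1 < 2 * k := by omega
  have hℓk' : ∀ r, Odd r → r ≤ 2 * k - 1 → r ≠ 2 * k - 1 → r + 2 < 2 * k := by
    rintro r ⟨s, hs⟩ h1 h2; omega
  generalize 2 * k - 1 = ℓ at *
  obtain ⟨T, hT⟩ := exists_isCycleSeq_of_hasCycleOfLength hH
  choose hTne a b hab ha hb using hT.adj
  have hnext : ∀ n x, ∃ y, n < ℓ → refinedColor G c (ℓ - n) x = refinedColor G c (ℓ - n) (a n) →
      G.Adj x y ∧ refinedColor G c (ℓ - (n + 1)) y = refinedColor G c (ℓ - (n + 1)) (a (n + 1)) := by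
    intro n x
    by_cases hn : n < ℓ ∧ refinedColor G c (ℓ - n) x = refinedColor G c (ℓ - n) (a n)
    · obtain ⟨hn, hx⟩ := hn
      rw [show ℓ - n = ℓ - (n + 1) + 1 by omega] at hx
      obtain ⟨y, hxy, hy⟩ := exists_adj_of_refinedColor_eq hx (hab n)
      refine ⟨y, fun _ _ => ⟨hxy, hy.trans ?_⟩⟩
      exact refinedColor_eq_of_le (Nat.sub_le _ _) ((hb n).trans (ha (n + 1)).symm)
    · exact ⟨x, fun h1 h2 => absurd ⟨h1, h2⟩ hn⟩
  choose nxt hnxt using hnext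
  let v : ℕ → V := fun n => Nat.rec (a 0) nxt n
  have hv : ∀ n ≤ ℓ, refinedColor G c (ℓ - n) (v n) = refinedColor G c (ℓ - n) (a n) := by
    intro n
    induction n with
    | zero => intro _; rfl
    | succ n ih => intro hn; exact (hnxt n (v n) (by omega) (ih (by omega))).2
  have hvadj : ∀ n < ℓ, G.Adj (v n) (v (n + 1)) := fun n hn =>
    (hnxt n (v n) hn (hv n hn.le)).1
  have hvc : ∀ n ≤ ℓ, c (v n) = c (a n) := fun n hn => eq_of_refinedColor_eq (hv n hn)
  have hshort : ∀ r f n, IsCycleSeq G r f → Odd r → 3 ≤ r → r ≤ ℓ → n ≤ ℓ → f 0 = v n →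
      refinedColor G c ℓ (v n) = T n := by
    intro r f n hf hodd hr3 hr hn hfn
    have hrℓ : r ≠ ℓ := by
      rintro rfl
      exact hG (hf.hasCycleOfLength hr3)
    have := hcyc r f hf hodd (hℓk' r hodd hr hrℓ) (a n) (by rw [hfn, hvc n hn])
    rw [← hfn, ← this, ha]
  rcases eq_or_ne (v 0) (v ℓ) with h0 | h0
  · let u : ℕ → V := fun n => v (n % ℓ)
    have hum : ∀ n, u (n + ℓ) = u n := fun n => by simp [u]
    have huadj : ∀ n, G.Adj (u n) (u (n + 1)) := by
      intro n
      have hlt := Nat.mod_lt n (show 0 < ℓ by omega)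
      rcases Nat.lt_or_ge (n % ℓ + 1) ℓ with h1 | h1
      · have : (n + 1) % ℓ = n % ℓ + 1 := by
          rw [Nat.add_mod, Nat.mod_eq_of_lt (a := 1) (by omega), Nat.mod_eq_of_lt h1]
        simp only [u, this]
        exact hvadj _ hlt
      · have h2 : n % ℓ + 1 = ℓ := by omega
        have : (n + 1) % ℓ = 0 := by
          rw [Nat.add_mod, Nat.mod_eq_of_lt (a := 1) (by omega), h2, Nat.mod_self]
        have h3 := hvadj _ hlt
        rw [h2, ← h0] at h3
        simp only [u, this]
        exact h3
    obtain ⟨i, j, hij, hj, hgap, heq, hmin, r, g, hg, hodd, hr3, hr, hg0⟩ :=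
      exists_minimal_odd_repetition (G := G) (f := u) (N := 2 * ℓ) (fun n _ => huadj n)
        (i := 0) (j := ℓ) (by omega) (by omega) (by simpa using hℓodd) (by simp [u])
    have hmod : ∀ n, n % ℓ ≤ ℓ := fun n => (Nat.mod_lt n (by omega)).le
    have h1 := hshort r g (i % ℓ) hg hodd hr3 (by omega) (hmod i) hg0
    have h2 := hshort r g (j % ℓ) hg hodd hr3 (by omega) (hmod j) (hg0.trans heq)
    have h3 : T i = T j := by
      rw [← hT.apply_mod i, ← hT.apply_mod j, ← h1, ← h2]
      exact congrArg _ heq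
    have h4 : j - i = ℓ := by
      by_contra hne
      have := hT.eq_of_le hij.le (by omega) h3
      omega
    rw [h4] at hmin
    refine hG (IsCycleSeq.hasCycleOfLength (f := u) ⟨huadj, hum, ?_⟩ hℓ3)
    have hinj : ∀ x y, x < y → y < ℓ → u x ≠ u y := by
      intro x y hxy hy he
      rcases Nat.even_or_odd (y - x) with hev | hod
      · have := hmin y (x + ℓ) (by omega) (by omega)
          (by rw [show x + ℓ - y = ℓ - (y - x) by omega]
              exact Nat.Odd.sub_even (by omega) hℓodd hev) (by rw [hum, he])
        omega
      · have := hmin x y hxy (by omega) hod he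
        omega
    intro x hx y hy he
    rcases lt_trichotomy x y with h | h | h
    · exact absurd he (hinj x y h hy)
    · exact h
    · exact absurd he.symm (hinj y x h hx)
  · obtain ⟨i', j', hij', hj', hodd', heq'⟩ :
        ∃ i j, i < j ∧ j ≤ ℓ ∧ Odd (j - i) ∧ v i = v j := by
      by_contra! hcon
      obtain ⟨p, hp, hl, hpar, -⟩ := exists_isPath_of_even_repetitions (G := G) (f := v)
        (Nat.zero_le ℓ) (fun n _ hn => hvadj n hn) (fun x y _ hxy hy he => by
          by_contra hne
          exact hcon x y hxy hy (Nat.not_even_iff_odd.1 hne) he)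
      have hc : c (v 0) = c (v ℓ) := by
        rw [hvc 0 (by omega), hvc ℓ le_rfl]
        refine eq_of_refinedColor_eq (G := G) (l := ℓ) ?_
        rw [ha, ha, ← hT.periodic 0, zero_add]
      have := hsep _ _ h0 hc p hp (by
        rwa [← Nat.not_even_iff_odd, hpar, Nat.not_even_iff_odd, Nat.sub_zero])
      omega
    obtain ⟨i, j, hij, hj, hgap, heq, hmin, r, g, hg, hodd, hr3, hr, hg0⟩ :=
      exists_minimal_odd_repetition hvadj hij' hj' hodd' heq'
    have h1 := hshort r g i hg hodd hr3 (by omega) (by omega) hg0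
    have h2 := hshort r g j hg hodd hr3 (by omega) (by omega) (hg0.trans heq)
    have h3 : T i = T j := by rw [← h1, ← h2, heq]
    have h4 : i = 0 ∧ j = ℓ := by
      by_contra hne
      have := hT.eq_of_le hij.le (by omega) h3
      omega
    rw [h4.1, h4.2] at heq
    exact h0 heq

end SimpleGraph

/-- Second part of Theorem 1.2: for `k ≥ 2`, `ε > 0` and `d ≥ 1` there is a constant
`C` such that every `{C_{2k+1}, C_{2k−1}}`-free graph `G` with VC-dimension at most
`d` and minimum degree at least `ε·n` admits a homomorphism to a `C_{2k−1}`-free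
graph on at most `C` vertices. -/
theorem two_odd_cycles_hom (k : ℕ) (hk : 2 ≤ k) (ε : ℝ) (hε : 0 < ε)
    (d : ℕ) (hd : 1 ≤ d) :
    ∃ C : ℕ, ∀ (V : Type) [Fintype V] (G : SimpleGraph V),
      ¬ HasCycleOfLength G (2 * k + 1) →
      ¬ HasCycleOfLength G (2 * k - 1) →
      VCdimLE G d →
      (∀ v : V, ε * (Nat.card V) ≤ (G.neighborSet v).ncard) →
      ∃ (W : Type) (_ : Finite W) (H : SimpleGraph W),
        Nat.card W ≤ C ∧ ¬ HasCycleOfLength H (2 * k - 1) ∧ Nonempty (G →g H) := by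
  obtain ⟨m, hm⟩ := exists_coloring_commonNeighbors d (ε := min ε 1) (lt_min hε one_pos)
    (min_le_right _ _)
  obtain ⟨N, hN⟩ := exists_nat_gt ((m + 4 * k) / (min ε 1 / 2))
  let α : Type := Fin m × Set (Fin (2 * k) × (Fin (2 * k) → Fin m))
  refine ⟨max N (Nat.card (RefinedColor α (2 * k - 1))), fun V _ G hG1 hG2 hvc hdeg => ?_⟩
  rcases le_or_gt (Nat.card V) N with hn | hn
  · exact ⟨V, inferInstance, G, hn.trans (le_max_left _ _), hG2, ⟨Hom.id⟩⟩
  obtain ⟨cl, hcl⟩ := hm V G hvc fun v => le_trans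
    (mul_le_mul_of_nonneg_right (min_le_left _ _) (Nat.cast_nonneg _)) (hdeg v)
  have hcl' : ∀ u v, cl u = cl v →
      Fintype.card (Fin m) + 4 * k < (G.neighborSet u ∩ G.neighborSet v).ncard := by
    intro u v h
    have h1 := hcl u v h
    have hpos : 0 < min ε 1 / 2 := half_pos (lt_min hε one_pos)
    rw [div_lt_iff₀ hpos] at hN
    have h2 : (N : ℝ) < Nat.card V := by exact_mod_cast hn
    have h3 := mul_lt_mul_of_pos_right h2 hpos
    rw [Fintype.card_fin, ← Nat.cast_lt (α := ℝ)]
    push_cast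
    linarith
  have hsep : ∀ u w, u ≠ w → cl u = cl w → ∀ p : G.Walk u w, p.IsPath → Odd p.length →
      2 * k ≤ p.length := fun u w huw h p hp hodd =>
    two_mul_le_length_of_odd_isPath hcl' hG1 huw h hp hodd
  have hcn : ∀ u v, cl u = cl v → ∀ F : Finset V, F.card ≤ 4 * k →
      ∃ y ∉ F, G.Adj u y ∧ G.Adj v y := by
    intro u v h F hF
    have := hcl' u v h
    obtain ⟨y, hy, hyF⟩ := Set.exists_mem_notMem_of_ncard_lt_ncard
      (s := (F : Set V)) (t := G.neighborSet u ∩ G.neighborSet v)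
      (by rw [Set.ncard_coe_finset]; omega)
    exact ⟨y, hyF, hy.1, hy.2⟩
  let c : V → α := cycleColor G cl k
  have hc : ∀ u w, c u = c w → cl u = cl w := fun u w h => congrArg Prod.fst h
  refine ⟨RefinedColor α (2 * k - 1), inferInstance,
    colorGraph G (refinedColor G c (2 * k - 1)), le_max_right _ _, ?_,
    ⟨⟨refinedColor G c (2 * k - 1), ?_⟩⟩⟩
  · exact not_hasCycleOfLength_colorGraph hk (fun u w huw h => hsep u w huw (hc u w h))
      (fun r f hf hodd hr v h => eq_of_cycleColor_eq hsep hcn hf hodd hr h) hG2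
  · intro u v huv
    refine ⟨fun h => ?_, u, v, huv, rfl, rfl⟩
    have := hsep u v huv.ne (hc u v (eq_of_refinedColor_eq h)) huv.toWalk
      (by simp [Walk.cons_isPath_iff, huv.ne]) (by simp)
    simp at this
    omega
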